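/- For every real constant c, the vector field V on ℝ⁴ with components V¹ = ((x⁴)²/4)(a + b) + (x⁴/2)(s + p) + 2c x¹, V² = c x², V³ = c x³, V⁴ = 0 satisfies the Ricci soliton equation (L_V g)_{ij} + ρ_{ij} = 2c·g_{ij} at every point; consequently the metric g determined by the real constants a, b, p, q, s is a shrinking, steady, and expanding Ricci soliton (the soliton constant λ = 2c can take any real value). -/

import Mathlib

noncomputable section

open scoped BigOperators

/-- The metric of a four-dimensional two-symmetric Lorentzian manifold, in
coordinates `x 0 = x¹, x 1 = x², x 2 = x³, x 3 = x⁴`: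
`g₁₄ = g₄₁ = g₂₂ = g₃₃ = 1`,
`g₄₄ = x⁴(a(x²)² + b(x³)²) + p(x²)² + 2q x²x³ + s(x³)²`, all others zero. -/
def gmat (a b p q s : ℝ) (x : Fin 4 → ℝ) : Matrix (Fin 4) (Fin 4) ℝ :=
  Matrix.of fun i j =>
    if i = 0 ∧ j = 3 then 1
    else if i = 3 ∧ j = 0 then 1
    else if i = 1 ∧ j = 1 then 1
    else if i = 2 ∧ j = 2 then 1
    else if i = 3 ∧ j = 3 then
      x 3 * (a * (x 1) ^ 2 + b * (x 2) ^ 2) + p * (x 1) ^ 2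
        + 2 * q * x 1 * x 2 + s * (x 2) ^ 2
    else 0

/-- The inverse matrix `g^{ij}`. -/
def ginv (a b p q s : ℝ) (x : Fin 4 → ℝ) : Matrix (Fin 4) (Fin 4) ℝ :=
  (gmat a b p q s x)⁻¹

/-- Partial derivative `∂_i` of a function on ℝ⁴. -/
def pd (i : Fin 4) (f : (Fin 4 → ℝ) → ℝ) (x : Fin 4 → ℝ) : ℝ :=
  fderiv ℝ f x (Pi.single i 1)

/-- Christoffel symbols `Γ^k_{ij} = (1/2) Σ_l g^{kl}(∂_i g_{jl} + ∂_j g_{il} − ∂_l g_{ij})`. -/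
def Gam (a b p q s : ℝ) (k i j : Fin 4) (x : Fin 4 → ℝ) : ℝ :=
  (1 / 2) * ∑ l, ginv a b p q s x k l *
    (pd i (fun y => gmat a b p q s y j l) x
      + pd j (fun y => gmat a b p q s y i l) x
      - pd l (fun y => gmat a b p q s y i j) x)

/-- Curvature tensor
`R^i_{jkl} = ∂_k Γ^i_{lj} − ∂_l Γ^i_{kj} + Σ_m (Γ^i_{km} Γ^m_{lj} − Γ^i_{lm} Γ^m_{kj})`. -/
def Riem (a b p q s : ℝ) (i j k l : Fin 4) (x : Fin 4 → ℝ) : ℝ :=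
  pd k (Gam a b p q s i l j) x - pd l (Gam a b p q s i k j) x
    + ∑ m, (Gam a b p q s i k m x * Gam a b p q s m l j x
      - Gam a b p q s i l m x * Gam a b p q s m k j x)

/-- Ricci tensor `ρ_{jl} = Σ_i R^i_{jil}`. -/
def Ric (a b p q s : ℝ) (j l : Fin 4) (x : Fin 4 → ℝ) : ℝ :=
  ∑ i, Riem a b p q s i j i l x

/-- Lie derivative of the metric along a vector field `V`:
`(L_V g)_{ij} = Σ_k (V^k ∂_k g_{ij} + g_{kj} ∂_i V^k + g_{ik} ∂_j V^k)`. -/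
def lieg (a b p q s : ℝ) (V : Fin 4 → (Fin 4 → ℝ) → ℝ) (i j : Fin 4)
    (x : Fin 4 → ℝ) : ℝ :=
  ∑ k, (V k x * pd k (fun y => gmat a b p q s y i j) x
    + gmat a b p q s x k j * pd i (V k) x
    + gmat a b p q s x i k * pd j (V k) x)

theorem pd_const (i : Fin 4) (r : ℝ) (x : Fin 4 → ℝ) : pd i (fun _ => r) x = 0 := by
  simp [pd]

theorem pd_coord (i j : Fin 4) (x : Fin 4 → ℝ) :
    pd i (fun y => y j) x = if j = i then 1 else 0 := by
  rw [pd, (hasFDerivAt_apply j x).fderiv]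
  simp [Pi.single_apply]

theorem pd_add (i : Fin 4) {f h : (Fin 4 → ℝ) → ℝ} {x : Fin 4 → ℝ}
    (hf : DifferentiableAt ℝ f x) (hh : DifferentiableAt ℝ h x) :
    pd i (fun y => f y + h y) x = pd i f x + pd i h x := by
  simp [pd, fderiv_fun_add hf hh]

theorem pd_mul (i : Fin 4) {f h : (Fin 4 → ℝ) → ℝ} {x : Fin 4 → ℝ}
    (hf : DifferentiableAt ℝ f x) (hh : DifferentiableAt ℝ h x) :
    pd i (fun y => f y * h y) x = f x * pd i h x + h x * pd i f x := by
  simp [pd, fderiv_fun_mul hf hh]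

theorem pd_sq (i : Fin 4) {f : (Fin 4 → ℝ) → ℝ} {x : Fin 4 → ℝ}
    (hf : DifferentiableAt ℝ f x) :
    pd i (fun y => f y ^ 2) x = 2 * f x * pd i f x := by
  simp only [pow_two]
  rw [pd_mul i hf hf]
  ring

theorem pd_div_const (i : Fin 4) {f : (Fin 4 → ℝ) → ℝ} {x : Fin 4 → ℝ} (r : ℝ)
    (hf : DifferentiableAt ℝ f x) :
    pd i (fun y => f y / r) x = pd i f x / r := by
  simp only [div_eq_mul_inv]
  rw [pd_mul i hf (by fun_prop), pd_const]
  ring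

/-- The component `g₄₄` of the metric. -/
def profile (a b p q s : ℝ) (x : Fin 4 → ℝ) : ℝ :=
  x 3 * (a * (x 1) ^ 2 + b * (x 2) ^ 2) + p * (x 1) ^ 2
    + 2 * q * x 1 * x 2 + s * (x 2) ^ 2

/-- The partial derivatives of `profile`. -/
def profileGrad (a b p q s : ℝ) (k : Fin 4) (x : Fin 4 → ℝ) : ℝ :=
  if k = 1 then 2 * a * (x 1 * x 3) + 2 * p * x 1 + 2 * q * x 2
  else if k = 2 then 2 * b * (x 2 * x 3) + 2 * q * x 1 + 2 * s * x 2
  else if k = 3 then a * (x 1) ^ 2 + b * (x 2) ^ 2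
  else 0

theorem pd_profile (a b p q s : ℝ) (k : Fin 4) (x : Fin 4 → ℝ) :
    pd k (profile a b p q s) x = profileGrad a b p q s k x := by
  unfold profile profileGrad
  simp (disch := fun_prop) only [pd_add, pd_mul, pd_sq, pd_const, pd_coord]
  fin_cases k <;> simp <;> ring

theorem gmat_eq (a b p q s : ℝ) (x : Fin 4 → ℝ) :
    gmat a b p q s x =
      !![0, 0, 0, 1; 0, 1, 0, 0; 0, 0, 1, 0; 1, 0, 0, profile a b p q s x] := by
  ext i j
  fin_cases i <;> fin_cases j <;> simp [gmat, profile]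

theorem ginv_eq (a b p q s : ℝ) (x : Fin 4 → ℝ) :
    ginv a b p q s x =
      !![-profile a b p q s x, 0, 0, 1; 0, 1, 0, 0; 0, 0, 1, 0; 1, 0, 0, 0] := by
  rw [ginv, gmat_eq]
  apply Matrix.inv_eq_right_inv
  ext i j
  fin_cases i <;> fin_cases j <;> simp [Matrix.mul_apply, Fin.sum_univ_four]

theorem pd_gmat (a b p q s : ℝ) (k i j : Fin 4) (x : Fin 4 → ℝ) :
    pd k (fun y => gmat a b p q s y i j) x =
      if i = 3 ∧ j = 3 then profileGrad a b p q s k x else 0 := by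
  rw [← pd_profile]
  simp only [gmat_eq]
  fin_cases i <;> fin_cases j <;> simp [pd_const]

theorem Gam_eq (a b p q s : ℝ) (k i j : Fin 4) :
    Gam a b p q s k i j = fun x =>
      if k = 0 ∧ i = 3 then profileGrad a b p q s j x / 2
      else if k = 0 ∧ j = 3 then profileGrad a b p q s i x / 2
      else if (k = 1 ∨ k = 2) ∧ i = 3 ∧ j = 3 then (-1 / 2) * profileGrad a b p q s k x
      else 0 := by
  funext x
  simp only [Gam, ginv_eq, pd_gmat, Fin.sum_univ_four]
  fin_cases k <;> fin_cases i <;> fin_cases j <;> simp [profileGrad] <;> ring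

theorem Ric_eq (a b p q s : ℝ) (j l : Fin 4) (x : Fin 4 → ℝ) :
    Ric a b p q s j l x =
      if j = 3 ∧ l = 3 then -(x 3 * (a + b) + p + s) else 0 := by
  simp only [Ric, Riem, Gam_eq, Fin.sum_univ_four]
  fin_cases j <;> fin_cases l <;> simp [profileGrad, pd_const] <;>
    simp (disch := fun_prop) [pd_add, pd_mul, pd_sq, pd_div_const, pd_const, pd_coord] <;> ring

/-- for every real constant `c`, the vector field
`V¹ = ((x⁴)²/4)(a + b) + (x⁴/2)(s + p) + 2c x¹`, `V² = c x²`, `V³ = c x³`, `V⁴ = 0`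
satisfies the Ricci soliton equation `L_V g + ρ = 2c·g`; hence `g` is a shrinking,
steady, and expanding Ricci soliton (the soliton constant `λ = 2c` is arbitrary). -/
theorem ricci_soliton (a b p q s c : ℝ) (x : Fin 4 → ℝ) (i j : Fin 4) :
    lieg a b p q s
      (fun k y =>
        if k = 0 then (y 3) ^ 2 / 4 * (a + b) + y 3 / 2 * (s + p) + 2 * c * y 0
        else if k = 1 then c * y 1
        else if k = 2 then c * y 2
        else 0)
      i j x + Ric a b p q s i j x = 2 * c * gmat a b p q s x i j := by
  rw [Ric_eq]
  simp only [lieg, pd_gmat, Fin.sum_univ_four]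
  simp only [gmat_eq]
  fin_cases i <;> fin_cases j <;> simp [profileGrad, profile, pd_const] <;>
    simp (disch := fun_prop) [pd_add, pd_mul, pd_sq, pd_div_const, pd_const, pd_coord] <;> ring
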